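/- Let α_1 < α_2 < ⋯ < α_k be a superincreasing sequence of real numbers and let a, b, c, d ∈ {1,…,k} be pairwise distinct. For an ordered pair (x,y) of distinct indices let ε(x,y) = 1 if α_y − α_x > 0 and ε(x,y) = 0 otherwise, and let ε'(x,y,z,w) = 1 if α_y − α_x + α_w − α_z > 0 and 0 otherwise. Then the sum of t^{ε(x,y)+ε(z,w)+ε'(x,y,z,w)} over the four choices ((x,y),(z,w)) ∈ {(a,b),(b,a)} × {(c,d),(d,c)} equals 1 + t + t^2 + t^3. -/

import Mathlib

open Polynomial

/-- In a superincreasing sequence, two distinct earlier terms sum to less than a later term. -/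
lemma add_lt_of_superincreasing {k : ℕ} {α : ℕ → ℝ} (hpos : ∀ m ∈ Set.Icc 1 k, 0 < α m)
    (hsup : ∀ m, 1 ≤ m → m ≤ k → ∑ j ∈ Finset.Ico 1 m, α j < α m)
    {x y m : ℕ} (hx : 1 ≤ x) (hy : 1 ≤ y) (hm : m ≤ k) (hxy : x ≠ y) (hxm : x < m) (hym : y < m) :
    α x + α y < α m := by
  refine lt_of_le_of_lt ?_ (hsup m (by omega) hm)
  rw [← Finset.sum_pair hxy]
  refine Finset.sum_le_sum_of_subset_of_nonneg (fun i hi => ?_) (fun i hi _ => ?_)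
  · simp only [Finset.mem_insert, Finset.mem_singleton] at hi
    rw [Finset.mem_Ico]
    omega
  · rw [Finset.mem_Ico] at hi
    exact (hpos i ⟨hi.1, by omega⟩).le

/-- In a superincreasing sequence, sums of two terms over disjoint pairs of indices differ. -/
lemma add_ne_add_of_superincreasing {k : ℕ} {α : ℕ → ℝ} (hpos : ∀ m ∈ Set.Icc 1 k, 0 < α m)
    (hsup : ∀ m, 1 ≤ m → m ≤ k → ∑ j ∈ Finset.Ico 1 m, α j < α m)
    {x y z w : ℕ} (hx : x ∈ Set.Icc 1 k) (hy : y ∈ Set.Icc 1 k) (hz : z ∈ Set.Icc 1 k)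
    (hw : w ∈ Set.Icc 1 k) (hxy : x ≠ y) (hxz : x ≠ z) (hxw : x ≠ w) (hyz : y ≠ z)
    (hyw : y ≠ w) (hzw : z ≠ w) :
    α x + α y ≠ α z + α w := by
  intro h
  have hpx := hpos x hx
  have hpy := hpos y hy
  have hpz := hpos z hz
  have hpw := hpos w hw
  have key := @add_lt_of_superincreasing k α hpos hsup
  have hmax : (x < z ∧ y < z) ∨ (x < w ∧ y < w) ∨ (z < x ∧ w < x) ∨ (z < y ∧ w < y) := by
    omega
  rcases hmax with ⟨h₁, h₂⟩ | ⟨h₁, h₂⟩ | ⟨h₁, h₂⟩ | ⟨h₁, h₂⟩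
  · linarith [key hx.1 hy.1 hz.2 hxy h₁ h₂]
  · linarith [key hx.1 hy.1 hw.2 hxy h₁ h₂]
  · linarith [key hz.1 hw.1 hx.2 hzw h₁ h₂]
  · linarith [key hz.1 hw.1 hy.2 hzw h₁ h₂]

/-- let `α_1 < α_2 < ⋯ < α_k` be a superincreasing sequence of real numbers
(`α_1 > 0` and `α_m > Σ_{j<m} α_j` for every `m`), and let `a, b, c, d ∈ {1,…,k}` be
pairwise distinct. For distinct indices set `ε(x,y) = 1` if `α_y − α_x > 0` and `0`
otherwise, and `ε'(x,y,z,w) = 1` if `α_y − α_x + α_w − α_z > 0` and `0` otherwise. Then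
`Σ t^(ε(x,y)+ε(z,w)+ε'(x,y,z,w)) = 1 + t + t² + t³`, the sum being over the four choices
`((x,y),(z,w)) ∈ {(a,b),(b,a)} × {(c,d),(d,c)}`. -/
theorem stmt14 (k : ℕ) (α : ℕ → ℝ)
    (hmono : StrictMonoOn α (Set.Icc 1 k))
    (h1 : 0 < α 1)
    (hsup : ∀ m, 1 ≤ m → m ≤ k → ∑ j ∈ Finset.Ico 1 m, α j < α m)
    (a b c d : ℕ)
    (ha : a ∈ Set.Icc 1 k) (hb : b ∈ Set.Icc 1 k) (hc : c ∈ Set.Icc 1 k)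
    (hd : d ∈ Set.Icc 1 k)
    (hab : a ≠ b) (hac : a ≠ c) (had : a ≠ d) (hbc : b ≠ c) (hbd : b ≠ d) (hcd : c ≠ d)
    (ε : ℕ → ℕ → ℕ)
    (hε : ∀ x y, (0 < α y - α x → ε x y = 1) ∧ (¬ 0 < α y - α x → ε x y = 0))
    (ε' : ℕ → ℕ → ℕ → ℕ → ℕ)
    (hε' : ∀ x y z w, (0 < α y - α x + (α w - α z) → ε' x y z w = 1) ∧
      (¬ 0 < α y - α x + (α w - α z) → ε' x y z w = 0)) :
    (X : Polynomial ℚ) ^ (ε a b + ε c d + ε' a b c d) +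
        X ^ (ε a b + ε d c + ε' a b d c) +
        X ^ (ε b a + ε c d + ε' b a c d) +
        X ^ (ε b a + ε d c + ε' b a d c) =
      1 + X + X ^ 2 + X ^ 3 := by
  have hpos : ∀ m ∈ Set.Icc 1 k, 0 < α m := fun m hm =>
    h1.trans_le (hmono.monotoneOn ⟨le_rfl, hm.1.trans hm.2⟩ hm hm.1)
  have hp : α a ≠ α b := hmono.injOn.ne ha hb hab
  have hq : α c ≠ α d := hmono.injOn.ne hc hd hcd
  have hadd : α a + α c ≠ α b + α d :=
    add_ne_add_of_superincreasing hpos hsup ha hc hb hd hac hab had hbc.symm hcd hbd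
  have hsub : α a + α d ≠ α b + α c :=
    add_ne_add_of_superincreasing hpos hsup ha hd hb hc had hab hac hbd.symm hcd.symm hbc
  have one_of_pos : ∀ {x y}, α x < α y → ε x y = 1 := fun h => (hε _ _).1 (by linarith)
  have zero_of_neg : ∀ {x y}, α y < α x → ε x y = 0 := fun h => (hε _ _).2 (by linarith)
  have one_of_pos' : ∀ {x y z w}, α x + α z < α y + α w → ε' x y z w = 1 :=
    fun h => (hε' _ _ _ _).1 (by linarith)
  have zero_of_neg' : ∀ {x y z w}, α y + α w < α x + α z → ε' x y z w = 0 :=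
    fun h => (hε' _ _ _ _).2 (by linarith)
  have hε_swap : ∀ {x y}, α x ≠ α y → ε y x = 1 - ε x y := fun h => by
    rcases h.lt_or_gt with h | h <;> rw [one_of_pos h, zero_of_neg h]
  have hε'_swap : ∀ {x y z w}, α x + α z ≠ α y + α w → ε' y x w z = 1 - ε' x y z w := fun h => by
    rcases h.lt_or_gt with h | h <;> rw [one_of_pos' h, zero_of_neg' h]
  rw [hε_swap hp, hε_swap hq, hε'_swap hadd, hε'_swap hsub]
  rcases hp.lt_or_gt with p | p <;> rcases hq.lt_or_gt with q | q <;>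
    rcases hadd.lt_or_gt with r | r <;> rcases hsub.lt_or_gt with s | s <;>
    first
    | (exfalso; linarith)
    | (simp only [p, q, r, s, one_of_pos, zero_of_neg, one_of_pos', zero_of_neg']
       ring)
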